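/- arXiv:1601.05132 — 3 statements merged into one kernel-verified Lean document; each statement's English description precedes it below -/
import Mathlib

section
/- Let x0 = x_0' < x_1 < … < x_N < x_{N+1} = xf be real numbers, L = xf - x0, and for 1 ≤ j ≤ N let χ_j(x) = tanh( L^5 / ( (x - x0)^2 (x - x_j) (xf - x)^2 ) ). Let a_0 ≤ a_1 ≤ … ≤ a_N be real numbers and define the approximant Ω(x) = (a_0 + a_N)/2 + Σ_{j=1}^{N} ((a_j - a_{j-1})/2) · χ_j(x). Then for every x ∈ (x0, xf) with x ∉ {x_1, …, x_N}, one has a_0 ≤ Ω(x) ≤ a_N; i.e. the approximant to a monotone step function never overshoots the extreme step values (absence of the Gibbs phenomenon). -/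
/-- Absence of the Gibbs phenomenon: the approximant
`Ω(x) = (a_0 + a_N)/2 + Σ_j ((a_j - a_{j-1})/2) χ_j(x)` to a monotone step function with
values `a_0 ≤ a_1 ≤ … ≤ a_N` never overshoots the extreme step values:
`a_0 ≤ Ω(x) ≤ a_N` on the whole domain away from the discontinuities. -/
theorem approximant_no_overshoot
    (N : ℕ) (hN : 1 ≤ N) (x0 xf : ℝ) (h0f : x0 < xf)
    (d : Fin N → ℝ) (hd : StrictMono d) (hdmem : ∀ j, d j ∈ Set.Ioo x0 xf)
    (a : Fin (N + 1) → ℝ) (ha : Monotone a) :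
    ∀ x ∈ Set.Ioo x0 xf, (∀ j, x ≠ d j) →
      a 0 ≤
        (a 0 + a (Fin.last N)) / 2 +
          ∑ j : Fin N, ((a j.succ - a j.castSucc) / 2) *
            Real.tanh ((xf - x0) ^ 5 /
              ((x - x0) ^ 2 * (x - d j) * (xf - x) ^ 2)) ∧
      (a 0 + a (Fin.last N)) / 2 +
          ∑ j : Fin N, ((a j.succ - a j.castSucc) / 2) *
            Real.tanh ((xf - x0) ^ 5 /
              ((x - x0) ^ 2 * (x - d j) * (xf - x) ^ 2)) ≤
        a (Fin.last N) := by
  intro x _ _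
  have tb : ∀ t : ℝ, -1 ≤ Real.tanh t ∧ Real.tanh t ≤ 1 := by
    intro t
    have hc := Real.cosh_pos t
    rw [Real.tanh_eq_sinh_div_cosh, le_div_iff₀ hc, div_le_iff₀ hc]
    have h1 := Real.exp_pos t
    have h2 := Real.exp_pos (-t)
    rw [Real.sinh_eq, Real.cosh_eq]
    constructor <;> linarith
  have tel : ∑ j : Fin N, (a j.succ - a j.castSucc) / 2 = (a (Fin.last N) - a 0) / 2 := by
    rw [← Finset.sum_div, Finset.sum_sub_distrib]
    have h1 := Fin.sum_univ_succ a
    have h2 := Fin.sum_univ_castSucc a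
    linarith
  have hnn : ∀ j : Fin N, 0 ≤ (a j.succ - a j.castSucc) / 2 := by
    intro j
    have := ha (Fin.castSucc_lt_succ (i := j)).le
    linarith
  have up : ∑ j : Fin N, ((a j.succ - a j.castSucc) / 2) *
            Real.tanh ((xf - x0) ^ 5 /
              ((x - x0) ^ 2 * (x - d j) * (xf - x) ^ 2)) ≤
      ∑ j : Fin N, (a j.succ - a j.castSucc) / 2 :=
    Finset.sum_le_sum fun j _ => mul_le_of_le_one_right (hnn j) (tb _).2
  have lo : ∑ j : Fin N, -((a j.succ - a j.castSucc) / 2) ≤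
      ∑ j : Fin N, ((a j.succ - a j.castSucc) / 2) *
            Real.tanh ((xf - x0) ^ 5 /
              ((x - x0) ^ 2 * (x - d j) * (xf - x) ^ 2)) := by
    refine Finset.sum_le_sum fun j _ => ?_
    have := mul_le_mul_of_nonneg_left (tb ((xf - x0) ^ 5 /
              ((x - x0) ^ 2 * (x - d j) * (xf - x) ^ 2))).1 (hnn j)
    linarith
  rw [Finset.sum_neg_distrib] at lo
  constructor <;> linarith
end

section
/- Let x0 < x_1 < … < x_N < xf be real numbers, L = xf - x0, x_{N+1} = xf, and for 1 ≤ j ≤ N let χ_j(x) = tanh( L^5 / ( (x - x0)^2 (x - x_j) (xf - x)^2 ) ). Let ψ_0, …, ψ_N : ℝ → ℝ be functions and define F_0 = (ψ_0 + ψ_N)/2, F_j = (ψ_j - ψ_{j-1})/2 for 1 ≤ j ≤ N, and Ω(x) = F_0(x) + Σ_{j=1}^{N} F_j(x) χ_j(x). Then for every n ∈ {0, …, N} and every x in the open partition interval (x_n, x_{n+1}), the error satisfies |Ω(x) - ψ_n(x)| ≤ (1/2) Σ_{j=1}^{N} |ψ_j(x) - ψ_{j-1}(x)| · |χ_j(x)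 - sgn(x - x_j)|. -/
theorem aux_tele (N : ℕ) (a : Fin (N + 1) → ℝ) (n : Fin (N + 1)) :
    ∑ j : Fin N, (a j.succ - a j.castSucc) * (if (j : ℕ) < (n : ℕ) then (1 : ℝ) else -1)
      = 2 * a n - a 0 - a (Fin.last N) := by
  induction N with
  | zero =>
    have : n = 0 := Fin.ext (by simp)
    subst this
    have h : Fin.last 0 = 0 := rfl
    rw [h]; simp; ring
  | succ N ih =>
    rw [Fin.sum_univ_castSucc]
    induction n using Fin.lastCases with
    | last =>
      have h := ih (fun i => a i.castSucc) (Fin.last N)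
      have e : ∀ j : Fin N, (j : ℕ) < N + 1 := fun j => by omega
      simp only [Fin.val_last, Fin.is_lt, if_true, Fin.castSucc_zero, Fin.val_castSucc,
        Fin.succ_castSucc, Fin.succ_last, e, Nat.lt_succ_self] at h ⊢
      rw [h]; ring
    | cast m =>
      have h := ih (fun i => a i.castSucc) m
      have e : ¬ (N < (m : ℕ)) := by omega
      simp only [Fin.val_last, Fin.castSucc_zero, Fin.val_castSucc,
        Fin.succ_castSucc, Fin.succ_last, e, if_false] at h ⊢
      rw [h]; ring

/-- Error bound for the approximant: with partition points
`x0 = p 0 < p 1 < … < p (N+1) = xf`, partition functions `ψ_0, …, ψ_N`, and approximant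
`Ω(x) = (ψ_0(x) + ψ_N(x))/2 + Σ_j ((ψ_j(x) - ψ_{j-1}(x))/2) χ_j(x)`, for every `n` and
every `x` in the open interval `(p n, p (n+1))` one has
`|Ω(x) - ψ_n(x)| ≤ (1/2) Σ_j |ψ_j(x) - ψ_{j-1}(x)| |χ_j(x) - sgn (x - x_j)|`. -/
theorem approximant_error_bound
    (N : ℕ) (hN : 1 ≤ N) (p : Fin (N + 2) → ℝ) (hp : StrictMono p)
    (ψ : Fin (N + 1) → ℝ → ℝ) :
    ∀ n : Fin (N + 1), ∀ x ∈ Set.Ioo (p n.castSucc) (p n.succ),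
      |((ψ 0 x + ψ (Fin.last N) x) / 2 +
            ∑ j : Fin N, ((ψ j.succ x - ψ j.castSucc x) / 2) *
              Real.tanh ((p (Fin.last (N + 1)) - p 0) ^ 5 /
                ((x - p 0) ^ 2 * (x - p j.succ.castSucc) *
                  (p (Fin.last (N + 1)) - x) ^ 2)))
          - ψ n x|
        ≤ (1 / 2) * ∑ j : Fin N, |ψ j.succ x - ψ j.castSucc x| *
            |Real.tanh ((p (Fin.last (N + 1)) - p 0) ^ 5 /
                ((x - p 0) ^ 2 * (x - p j.succ.castSucc) *
                  (p (Fin.last (N + 1)) - x) ^ 2))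
              - Real.sign (x - p j.succ.castSucc)| := by
  intro n x hx
  have hs : ∀ j : Fin N, Real.sign (x - p j.succ.castSucc)
      = if (j : ℕ) < (n : ℕ) then (1 : ℝ) else -1 := by
    intro j
    split_ifs with h
    · apply Real.sign_of_pos
      have : p j.succ.castSucc ≤ p n.castSucc := hp.monotone (by
        rw [Fin.le_def]; simp; omega)
      linarith [hx.1]
    · apply Real.sign_of_neg
      have : p n.succ ≤ p j.succ.castSucc := hp.monotone (by
        rw [Fin.le_def]; simp; omega)
      linarith [hx.2]
  have ht := aux_tele N (fun i => ψ i x) n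
  simp only [hs]
  generalize hc : (fun j : Fin N => Real.tanh ((p (Fin.last (N + 1)) - p 0) ^ 5 /
                ((x - p 0) ^ 2 * (x - p j.succ.castSucc) *
                  (p (Fin.last (N + 1)) - x) ^ 2))) = c
  have hc' := fun j => congrFun hc j
  simp only [hc']
  have key : (ψ 0 x + ψ (Fin.last N) x) / 2 +
      ∑ j : Fin N, ((ψ j.succ x - ψ j.castSucc x) / 2) * c j - ψ n x
      = ∑ j : Fin N, (1 / 2) * ((ψ j.succ x - ψ j.castSucc x) *
        (c j - if (j : ℕ) < (n : ℕ) then (1 : ℝ) else -1)) := by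
    have e : ∀ j : Fin N, (1 / 2) * ((ψ j.succ x - ψ j.castSucc x) *
        (c j - if (j : ℕ) < (n : ℕ) then (1 : ℝ) else -1))
        = ((ψ j.succ x - ψ j.castSucc x) / 2) * c j - (1 / 2) *
          ((ψ j.succ x - ψ j.castSucc x) * if (j : ℕ) < (n : ℕ) then (1 : ℝ) else -1) :=
      fun j => by ring
    rw [Finset.sum_congr rfl fun j _ => e j, Finset.sum_sub_distrib, ← Finset.mul_sum, ht]
    ring
  rw [key, Finset.mul_sum]
  refine (Finset.abs_sum_le_sum_abs _ _).trans (Finset.sum_le_sum fun j _ => ?_)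
  rw [abs_mul, abs_mul, abs_of_pos (by norm_num : (0 : ℝ) < 1 / 2)]
end

section
/- Let m > 0, k > 0, f0 be real numbers, ω = √(k/m), and t1 < t2. Define the discontinuous force f : ℝ → ℝ by f(t) = f0 for t ∈ [t1, t2] and f(t) = 0 otherwise, and define x : ℝ → ℝ piecewise by x(t) = 0 for t ≤ t1, x(t) = (f0/k)(1 - cos(ω(t - t1))) for t1 ≤ t ≤ t2, and x(t) = (f0/k)(cos(ω(t - t2)) - cos(ω(t - t1))) for t ≥ t2. Then x is continuously differentiable on all of ℝ (the pieces match in value and first derivative at t1 and t2), and for every t ∉ {t1, t2} it satisfies the oscillator equation m x''(t) + k x(t) = f(t). -/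
theorem glue_ne {f g : ℝ → ℝ} {f' g' : ℝ} {a t : ℝ}
    (hf : t ≤ a → HasDerivAt f f' t) (hg : a < t → HasDerivAt g g' t) (h : t ≠ a) :
    HasDerivAt (fun t => if t ≤ a then f t else g t) (if t ≤ a then f' else g') t := by
  rcases lt_or_gt_of_ne h with h | h
  · rw [if_pos h.le]
    refine (hf h.le).congr_of_eventuallyEq ?_
    filter_upwards [Iio_mem_nhds h] with s hs
    exact if_pos (le_of_lt hs)
  · rw [if_neg (not_le.2 h)]
    refine (hg h).congr_of_eventuallyEq ?_
    filter_upwards [Ioi_mem_nhds h] with s hs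
    exact if_neg (not_le.2 hs)

theorem glue_all {f g f' g' : ℝ → ℝ} {a : ℝ}
    (hf : ∀ t, HasDerivAt f (f' t) t) (hg : ∀ t, HasDerivAt g (g' t) t)
    (h0 : f a = g a) (h1 : f' a = g' a) (t : ℝ) :
    HasDerivAt (fun t => if t ≤ a then f t else g t) (if t ≤ a then f' t else g' t) t := by
  by_cases h : t = a
  · subst h
    rw [if_pos le_rfl, ← hasDerivWithinAt_univ, ← Set.Iic_union_Ici (a := t)]
    apply HasDerivWithinAt.union
    · exact (hf t).hasDerivWithinAt.congr (fun s hs => if_pos hs) (if_pos le_rfl)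
    · rw [h1]
      have key : ∀ s ∈ Set.Ici t, (if s ≤ t then f s else g s) = g s := by
        intro s hs
        split_ifs with h
        · rw [le_antisymm h hs, h0]
        · rfl
      exact (hg t).hasDerivWithinAt.congr key (key t Set.self_mem_Ici)
  · exact glue_ne (fun _ => hf t) (fun _ => hg t) h

/-- Landau–Lifschitz oscillator under a finite-duration constant force: the piecewise
function `x(t)` (zero before `t1`, `(f0/k)(1 - cos ω(t-t1))` on `[t1, t2]`, and
`(f0/k)(cos ω(t-t2) - cos ω(t-t1))` after `t2`, with `ω = √(k/m)`) is continuously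
differentiable on all of `ℝ`, and away from `t1`, `t2` it satisfies
`m x'' + k x = f` where `f = f0` on `[t1, t2]` and `f = 0` otherwise. -/
theorem landau_oscillator_piecewise_solution
    (m k f0 t1 t2 : ℝ) (hm : 0 < m) (hk : 0 < k) (ht : t1 < t2) :
    ∃ x' : ℝ → ℝ,
      Continuous x' ∧
      (∀ t : ℝ, HasDerivAt
          (fun t : ℝ =>
            if t ≤ t1 then 0
            else if t ≤ t2 then (f0 / k) * (1 - Real.cos (Real.sqrt (k / m) * (t - t1)))
            else (f0 / k) * (Real.cos (Real.sqrt (k / m) * (t - t2)) -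
              Real.cos (Real.sqrt (k / m) * (t - t1))))
          (x' t) t) ∧
      (∀ t : ℝ, t ≠ t1 → t ≠ t2 →
        ∃ x'' : ℝ, HasDerivAt x' x'' t ∧
          m * x'' + k *
              (if t ≤ t1 then 0
               else if t ≤ t2 then (f0 / k) * (1 - Real.cos (Real.sqrt (k / m) * (t - t1)))
               else (f0 / k) * (Real.cos (Real.sqrt (k / m) * (t - t2)) -
                 Real.cos (Real.sqrt (k / m) * (t - t1))))
            = (if t1 ≤ t ∧ t ≤ t2 then f0 else 0)) := by
  set w := Real.sqrt (k / m) with hw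
  have hw2 : m * (w * w) = k := by
    rw [hw, Real.mul_self_sqrt (by positivity)]
    field_simp
  have hc : ∀ a t : ℝ, HasDerivAt (fun t : ℝ => Real.cos (w * (t - a)))
      (-(w * Real.sin (w * (t - a)))) t := by
    intro a t
    have h := (((hasDerivAt_id t).sub_const a).const_mul w).cos
    simp only [id] at h
    convert h using 1
    ring
  have hs : ∀ a t : ℝ, HasDerivAt (fun t : ℝ => Real.sin (w * (t - a)))
      (w * Real.cos (w * (t - a))) t := by
    intro a t
    have h := (((hasDerivAt_id t).sub_const a).const_mul w).sin
    simp only [id] at h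
    convert h using 1
    ring
  have hp : ∀ t, HasDerivAt (fun t : ℝ => (f0 / k) * (1 - Real.cos (w * (t - t1))))
      ((f0 / k) * (w * Real.sin (w * (t - t1)))) t := by
    intro t
    refine (((hc t1 t).const_sub 1).const_mul (f0 / k)).congr_deriv ?_
    ring
  have hq : ∀ t, HasDerivAt
      (fun t : ℝ => (f0 / k) * (Real.cos (w * (t - t2)) - Real.cos (w * (t - t1))))
      ((f0 / k) * (w * Real.sin (w * (t - t1)) - w * Real.sin (w * (t - t2)))) t := by
    intro t
    refine (((hc t2 t).sub (hc t1 t)).const_mul (f0 / k)).congr_deriv ?_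
    ring
  have hp' : ∀ t, HasDerivAt (fun t : ℝ => (f0 / k) * (w * Real.sin (w * (t - t1))))
      ((f0 / k) * (w * (w * Real.cos (w * (t - t1))))) t :=
    fun t => ((hs t1 t).const_mul w).const_mul (f0 / k)
  have hq' : ∀ t, HasDerivAt
      (fun t : ℝ => (f0 / k) * (w * Real.sin (w * (t - t1)) - w * Real.sin (w * (t - t2))))
      ((f0 / k) * (w * (w * Real.cos (w * (t - t1))) - w * (w * Real.cos (w * (t - t2))))) t :=
    fun t => (((hs t1 t).const_mul w).sub ((hs t2 t).const_mul w)).const_mul (f0 / k)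
  have h12 := glue_all hp hq (a := t2) (by simp) (by simp)
  refine ⟨fun t => if t ≤ t1 then 0 else if t ≤ t2 then (f0 / k) * (w * Real.sin (w * (t - t1)))
    else (f0 / k) * (w * Real.sin (w * (t - t1)) - w * Real.sin (w * (t - t2))), ?_, ?_, ?_⟩
  · refine Continuous.if_le (by fun_prop) (Continuous.if_le (by fun_prop) (by fun_prop)
      (by fun_prop) (by fun_prop) ?_) (by fun_prop) (by fun_prop) ?_
    · rintro t rfl
      simp
    · rintro t rfl
      simp [ht.le]
  · exact glue_all (f := fun _ => 0) (f' := fun _ => 0) (fun t => hasDerivAt_const t 0) h12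
      (by simp [ht.le]) (by simp [ht.le])
  · intro t n1 n2
    refine ⟨_, glue_ne (f := fun _ => 0) (fun _ => hasDerivAt_const t 0)
      (fun _ => glue_ne (fun _ => hp' t) (fun _ => hq' t) n2) n1, ?_⟩
    have hk' := hk.ne'
    have e : ∀ z : ℝ, m * ((f0 / k) * (w * (w * z))) = f0 * z := by
      intro z
      calc _ = (m * (w * w)) * (f0 / k) * z := by ring
        _ = _ := by rw [hw2]; field_simp
    have e2 : ∀ z : ℝ, k * ((f0 / k) * z) = f0 * z := by
      intro z
      field_simp
    by_cases a1 : t ≤ t1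
    · have : ¬ (t1 ≤ t ∧ t ≤ t2) := fun h => n1 (le_antisymm a1 h.1)
      simp [a1, this]
    · by_cases a2 : t ≤ t2
      · have : t1 ≤ t ∧ t ≤ t2 := ⟨(not_le.1 a1).le, a2⟩
        rw [if_neg a1, if_neg a1, if_pos a2, if_pos a2, if_pos this, e, e2]
        ring
      · have : ¬ (t1 ≤ t ∧ t ≤ t2) := fun h => a2 h.2
        rw [if_neg a1, if_neg a1, if_neg a2, if_neg a2, if_neg this, e2, mul_sub (f0 / k),
          mul_sub m, e, e]
        ring
end
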